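/- Let C be a finitary Ramsey class of L-structures (assumed L'_{∞,0}-orderable: there is a linear preorder on tuples determined by quantifier-free types, linear on every member of C). Then for every M ∈ C and all distinct same-length tuples b̄₁, b̄₂ from M with the same quantifier-free type, the substructures generated by b̄₁ and b̄₂ are distinct. Equivalently: no L-term t satisfies t(b̄₁) = b̄₂ with ⟨b̄₁⟩ = ⟨b̄₂⟩. -/

import Mathlib

open FirstOrder Language CategoryTheory

/-- The quantifier-free type of a tuple. -/
def qftp (L : Language) (M : Type*) [L.Structure M] {α : Type*} (v : α → M) :
    Set (L.Formula α) :=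
  {φ | BoundedFormula.IsQF φ ∧ φ.Realize v}

/-- `s` is a copy (in `N`) of the tuple `v` (from `M`). -/
def IsCopyOf (L : Language) {M N : Type*} [L.Structure M] [L.Structure N] {α : Type*}
    (v : α → M) (s : Set N) : Prop :=
  ∃ e : α → N, Set.range e = s ∧ qftp L N e = qftp L M v

/-- The structural partition arrow for copies: every 2-colouring of subsets of `N` admits a
copy `s ⊆ C` of `b` such that all copies of `a` inside `s` get the same colour. -/
def CopyArrow (L : Language) {M N : Type*} [L.Structure M] [L.Structure N] {α β : Type*}
    (a : α → M) (b : β → M) (C : Set N) : Prop :=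
  ∀ χ : Set N → Fin 2, ∃ s : Set N, s ⊆ C ∧ IsCopyOf L b s ∧
    ∀ t u : Set N, t ⊆ s → u ⊆ s → IsCopyOf L a t → IsCopyOf L a u → χ t = χ u

/-- The class `K` has the finitary Embedding Ramsey Property. -/
def ClassFERP (L : Language) (K : Set (Bundled L.Structure)) : Prop :=
  ∀ M ∈ K, ∀ (n m : ℕ) (a : Fin n → ↥M) (b : Fin m → ↥M), Set.range a ⊆ Set.range b →
    ∃ N ∈ K, ∃ C : Set ↥N, C.Finite ∧ CopyArrow L a b C

namespace QFType

/-- Quantifier-free formulas are closed under substitution of terms. -/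
theorem isQF_subst {L : Language} {α β : Type*} {n : ℕ} {φ : L.BoundedFormula α n}
    (h : φ.IsQF) (s : α → L.Term β) : (φ.subst s).IsQF := by
  induction h with
  | falsum => exact .falsum
  | of_isAtomic h =>
    cases h with
    | equal t u => exact (BoundedFormula.IsAtomic.equal _ _).isQF
    | rel R t => exact (BoundedFormula.IsAtomic.rel _ _).isQF
  | imp _ _ ih₁ ih₂ => exact ih₁.imp ih₂

variable {L : Language} {M N : Type*} [L.Structure M] [L.Structure N] {α β : Type*}

/-- Tuples of the same quantifier-free type satisfy the same quantifier-free formulas. -/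
theorem realize_iff {v : α → M} {w : α → N} (h : qftp L M v = qftp L N w)
    {φ : L.Formula α} (hφ : BoundedFormula.IsQF φ) : φ.Realize v ↔ φ.Realize w :=
  ⟨fun hv => (h.subset ⟨hφ, hv⟩ : φ ∈ qftp L N w).2,
    fun hw => (h.superset ⟨hφ, hw⟩ : φ ∈ qftp L M v).2⟩

/-- Evaluating terms preserves equality of quantifier-free types. -/
theorem qftp_realize {v : α → M} {w : α → N} (h : qftp L M v = qftp L N w)
    (s : β → L.Term α) :
    qftp L M (fun i => (s i).realize v) = qftp L N (fun i => (s i).realize w) := by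
  ext φ
  refine and_congr_right fun hφ => ?_
  have := realize_iff h (φ := BoundedFormula.subst φ s) (isQF_subst hφ s)
  simpa only [Formula.Realize, BoundedFormula.realize_subst] using this

theorem qftp_comp {v : α → M} {w : α → N} (h : qftp L M v = qftp L N w) (f : β → α) :
    qftp L M (v ∘ f) = qftp L N (w ∘ f) :=
  qftp_realize h fun i => Term.var (f i)

theorem qftp_pair {v : α → M} {w : α → N} (h : qftp L M v = qftp L N w) (t u : L.Term α) :
    qftp L M ![t.realize v, u.realize v] = qftp L N ![t.realize w, u.realize w] := by
  convert qftp_realize h ![t, u] using 2 <;> ext i <;> fin_cases i <;> rfl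

/-- The quantifier-free type of a tuple decides equalities between terms. -/
theorem realize_eq_iff {v : α → M} {w : α → N} (h : qftp L M v = qftp L N w)
    (t u : L.Term α) : t.realize v = u.realize v ↔ t.realize w = u.realize w := by
  have hQF : BoundedFormula.IsQF (t.equal u) := (BoundedFormula.IsAtomic.equal _ _).isQF
  simpa only [Formula.realize_equal] using realize_iff h hQF

end QFType

/-- A strictly monotone sequence for a transitive antisymmetric relation is injective. -/
theorem injective_of_rel_succ {α : Type*} (r : α → α → Prop) [IsTrans α r] [Std.Antisymm r]
    {f : ℕ → α} (hr : ∀ k, r (f k) (f (k + 1))) (hne : ∀ k, f k ≠ f (k + 1)) :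
    Function.Injective f := by
  have hlt : ∀ k d, r (f k) (f (k + d + 1)) := by
    intro k d
    induction d with
    | zero => exact hr k
    | succ d ih => exact _root_.trans ih (hr _)
  have key : ∀ k d, f k ≠ f (k + d + 1) := by
    intro k d h
    cases d with
    | zero => exact hne k h
    | succ d =>
      have hback : r (f (k + d + 1)) (f k) := h ▸ hr (k + d + 1)
      have hk : f k = f (k + d + 1) := antisymm (hlt k d) hback
      exact hne (k + d + 1) (hk.symm.trans h)
  intro k l h
  rcases lt_trichotomy k l with hkl | hkl | hkl
  · obtain ⟨d, rfl⟩ := Nat.exists_eq_add_of_lt hkl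
    exact (key _ _ h).elim
  · exact hkl
  · obtain ⟨d, rfl⟩ := Nat.exists_eq_add_of_lt hkl
    exact (key _ _ h.symm).elim

/-- A sequence of distinct consecutive terms, all of whose consecutive pairs have the same
quantifier-free type, is injective when that type decides a linear order. -/
theorem injective_of_qftp_succ {L : Language} {N : Type*} [L.Structure N]
    {S : Set (Set (L.Formula (Fin 2)))} (hS : IsLinearOrder N (fun a b => qftp L N ![a, b] ∈ S))
    {f : ℕ → N} (hne : ∀ k, f k ≠ f (k + 1))
    (hf : ∀ k, qftp L N ![f k, f (k + 1)] = qftp L N ![f 0, f 1]) : Function.Injective f := by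
  have hswap : ∀ k, qftp L N ![f (k + 1), f k] = qftp L N ![f 1, f 0] := fun k =>
    QFType.qftp_pair (hf k) (Term.var 1) (Term.var 0)
  rcases hS.total (f 0) (f 1) with h | h
  · exact injective_of_rel_succ (fun a b => qftp L N ![a, b] ∈ S)
      (fun k => (hf k).symm ▸ h) hne
  · have : IsTrans N (fun a b => qftp L N ![b, a] ∈ S) := ⟨fun a b c hab hbc =>
      hS.trans c b a hbc hab⟩
    have : Std.Antisymm (fun a b => qftp L N ![b, a] ∈ S) := ⟨fun a b hab hba =>
      hS.antisymm a b hba hab⟩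
    exact injective_of_rel_succ (fun a b => qftp L N ![b, a] ∈ S)
      (fun k => (hswap k).symm ▸ h) hne

/-- Finite tuples with the same quantifier-free type and the same range coincide, when
quantifier-free types decide a linear order. -/
theorem eq_of_qftp_eq_of_range_eq {L : Language} {N : Type*} [L.Structure N]
    {S : Set (Set (L.Formula (Fin 2)))} (hS : IsLinearOrder N (fun a b => qftp L N ![a, b] ∈ S))
    {α : Type*} [Finite α] {e e' : α → N} (h : qftp L N e = qftp L N e')
    (hrange : Set.range e = Set.range e') : e = e' := by
  have hmem : ∀ i, ∃ j, e j = e' i := fun i => hrange.superset ⟨i, rfl⟩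
  choose σ hσ using hmem
  obtain rfl : e ∘ σ = e' := funext hσ
  by_contra hne
  obtain ⟨i, hi⟩ := Function.ne_iff.1 hne
  have hcomp : ∀ k, qftp L N (e ∘ σ^[k]) = qftp L N e := by
    intro k
    induction k with
    | zero => rfl
    | succ k ih =>
      rw [Function.iterate_succ, ← Function.comp_assoc]
      exact (QFType.qftp_comp ih σ).trans h.symm
  have hinj : Function.Injective fun k => e (σ^[k] i) := by
    refine injective_of_qftp_succ hS (fun k hk => hi ?_) fun k => ?_
    · refine (QFType.realize_eq_iff (hcomp k) (Term.var i) (Term.var (σ i))).1 ?_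
      exact hk
    · exact QFType.qftp_pair (hcomp k) (Term.var i) (Term.var (σ i))
  exact not_injective_infinite_finite (fun k => σ^[k] i) fun k l hkl =>
    hinj (congrArg e hkl)

/-- If the orbits of `T` starting in `P` leave `P`, there is a 2-colouring in which `T` changes
the colour of points of `P`. -/
theorem exists_coloring_iterate {X : Type*} (T : X → X) (P : X → Prop) :
    ∃ c : X → Fin 2, ∀ x, P x → (∃ k, ¬ P (T^[k] x)) → c (T x) ≠ c x := by
  classical
  refine ⟨fun x => if h : ∃ k, ¬ P (T^[k] x) then Fin.ofNat 2 (Nat.find h) else 0, ?_⟩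
  intro x hx h
  have h' : ∃ k, ¬ P (T^[k] (T x)) := by
    obtain ⟨_ | k, hk⟩ := h
    · exact (hk hx).elim
    · exact ⟨k, hk⟩
  have hfind : Nat.find h = Nat.find h' + 1 := Nat.find_comp_succ h h' (not_not.2 hx)
  beta_reduce
  rw [dif_pos h, dif_pos h', hfind, Ne, Fin.ext_iff]
  simp only [Fin.ofNat]
  omega

/-- Elements of the substructure generated by a tuple are values of terms at that tuple. -/
theorem exists_term_of_mem_closure_range {L : Language} {M : Type*} [L.Structure M] {α : Type*}
    {v : α → M} {x : M} (hx : x ∈ Substructure.closure L (Set.range v)) :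
    ∃ t : L.Term α, t.realize v = x := by
  obtain ⟨t, rfl⟩ := Substructure.mem_closure_iff_exists_term.1 hx
  refine ⟨t.relabel fun y => y.2.choose, ?_⟩
  rw [Term.realize_relabel]
  congr 1
  exact funext fun y => y.2.choose_spec

/-- In a finitary Ramsey class (HP, JEP, f-ERP) equipped with a linear order on each member
which is determined by quantifier-free 2-types, distinct same-length tuples with the same
quantifier-free type generate distinct substructures. -/
theorem distinct_generated_substructures (L : Language) (K : Set (Bundled L.Structure))
    (hHP : ∀ M ∈ K, ∀ S : L.Substructure ↥M, ∃ B ∈ K, Nonempty (↥S ≃[L] ↥B))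
    (hJEP : ∀ A ∈ K, ∀ B ∈ K, ∃ D ∈ K, Nonempty (↥A ↪[L] ↥D) ∧ Nonempty (↥B ↪[L] ↥D))
    (hferp : ClassFERP L K)
    (S : Set (Set (L.Formula (Fin 2))))
    (hord : ∀ M ∈ K, IsLinearOrder ↥M (fun a b => qftp L ↥M ![a, b] ∈ S)) :
    ∀ M ∈ K, ∀ (n : ℕ) (b₁ b₂ : Fin n → ↥M), b₁ ≠ b₂ → qftp L ↥M b₁ = qftp L ↥M b₂ →
      Substructure.closure L (Set.range b₁) ≠ Substructure.closure L (Set.range b₂) := by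
  classical
  intro M hM n b₁ b₂ hne hqf hcl
  have hterm : ∀ i, ∃ t : L.Term (Fin n), t.realize b₁ = b₂ i := fun i =>
    exists_term_of_mem_closure_range (hcl ▸ Substructure.subset_closure ⟨i, rfl⟩)
  choose t ht using hterm
  obtain ⟨i, hi⟩ := Function.ne_iff.1 hne
  obtain ⟨N, hN, C, hC, harrow⟩ := hferp M hM n (n + n) b₁ (Fin.append b₁ b₂) (by
    rintro _ ⟨j, rfl⟩
    exact ⟨Fin.castAdd n j, Fin.append_left b₁ b₂ j⟩)
  let T : (Fin n → ↥N) → (Fin n → ↥N) := fun e j => (t j).realize e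
  have hT : ∀ e, qftp L ↥N e = qftp L ↥M b₁ → qftp L ↥N (T e) = qftp L ↥M b₁ := fun e he =>
    (QFType.qftp_realize he t).trans ((congrArg (qftp L ↥M) (funext ht)).trans hqf.symm)
  have hiter : ∀ e, qftp L ↥N e = qftp L ↥M b₁ → ∀ k,
      qftp L ↥N (T^[k] e) = qftp L ↥M b₁ := by
    intro e he k
    induction k with
    | zero => exact he
    | succ k ih => rw [Function.iterate_succ_apply']; exact hT _ ih
  have hleave : ∀ e, qftp L ↥N e = qftp L ↥M b₁ → ∃ k, ¬ Set.range (T^[k] e) ⊆ C := by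
    intro e he
    have hinj : Function.Injective fun k => T^[k] e i := by
      refine injective_of_qftp_succ (hord N hN) (fun k hk => hi ?_) fun k => ?_
      · rw [Function.iterate_succ_apply'] at hk
        exact ((QFType.realize_eq_iff (hiter e he k) (Term.var i) (t i)).1 hk).trans (ht i)
      · rw [Function.iterate_succ_apply']
        exact QFType.qftp_pair ((hiter e he k).trans he.symm) (Term.var i) (t i)
    by_contra! hall
    exact Set.infinite_range_of_injective hinj
      (hC.subset (Set.range_subset_iff.2 fun k => hall k ⟨i, rfl⟩))
  obtain ⟨c, hc⟩ := exists_coloring_iterate T fun e => Set.range e ⊆ C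
  obtain ⟨s, hsC, ⟨e, rfl, he⟩, hmono⟩ := harrow fun s =>
    if h : IsCopyOf L b₁ s then c h.choose else 0
  have hcolor : ∀ e : Fin n → ↥N, qftp L ↥N e = qftp L ↥M b₁ →
      ∀ h : IsCopyOf L b₁ (Set.range e), h.choose = e := fun e he h =>
    eq_of_qftp_eq_of_range_eq (hord N hN) (h.choose_spec.2.trans he.symm) h.choose_spec.1
  have he₁ : qftp L ↥N (e ∘ Fin.castAdd n) = qftp L ↥M b₁ := by
    refine (QFType.qftp_comp he _).trans (congrArg _ (funext fun j => ?_))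
    exact Fin.append_left b₁ b₂ j
  have he₂ : e ∘ Fin.natAdd n = T (e ∘ Fin.castAdd n) := by
    funext j
    have := QFType.realize_eq_iff he (Term.var (Fin.natAdd n j)) ((t j).relabel (Fin.castAdd n))
    simp only [Term.realize_var, Term.realize_relabel] at this
    refine this.2 ?_
    have hb : Fin.append b₁ b₂ ∘ Fin.castAdd n = b₁ := funext (Fin.append_left b₁ b₂)
    rw [hb, ht, Fin.append_right]
  have hsub₁ : Set.range (e ∘ Fin.castAdd n) ⊆ Set.range e := Set.range_comp_subset_range _ _
  have hsub₂ : Set.range (T (e ∘ Fin.castAdd n)) ⊆ Set.range e :=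
    he₂ ▸ Set.range_comp_subset_range _ _
  have hcopy₁ : IsCopyOf L b₁ (Set.range (e ∘ Fin.castAdd n)) := ⟨_, rfl, he₁⟩
  have hcopy₂ : IsCopyOf L b₁ (Set.range (T (e ∘ Fin.castAdd n))) := ⟨_, rfl, hT _ he₁⟩
  have heq := hmono _ _ hsub₂ hsub₁ hcopy₂ hcopy₁
  rw [dif_pos hcopy₁, dif_pos hcopy₂, hcolor _ he₁ hcopy₁, hcolor _ (hT _ he₁) hcopy₂] at heq
  exact hc _ (hsub₁.trans hsC) (hleave _ he₁) heq
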